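/- Let k be an algebraically closed field of characteristic zero and let g ∈ GL₃(k) be such that the conjugation map Ad(g) : M₃(k) → M₃(k), X ↦ g X g⁻¹, is an involution (Ad(g) ∘ Ad(g) = id). Then Ad(g) preserves the subspace sl₃(k) of trace-zero 3×3 matrices, and the trace of the restriction of Ad(g) to sl₃(k) is equal to 0 or 8; in particular it is never equal to −2. -/

import Mathlib

/-- Conjugation by `g` as a linear endomorphism of `3 × 3` matrices. -/
def adL {k : Type*} [Field k] (g : Matrix.GeneralLinearGroup (Fin 3) k) :
    Matrix (Fin 3) (Fin 3) k →ₗ[k] Matrix (Fin 3) (Fin 3) k where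
  toFun X := (g : Matrix (Fin 3) (Fin 3) k) * X * ((g⁻¹ : Matrix.GeneralLinearGroup (Fin 3) k) : Matrix (Fin 3) (Fin 3) k)
  map_add' X Y := by simp [Matrix.mul_add, Matrix.add_mul]
  map_smul' c X := by simp [Matrix.mul_smul, Matrix.smul_mul]

/-- The trace-zero `3 × 3` matrices, i.e. `sl₃`. -/
def sl3 (k : Type*) [Field k] : Submodule k (Matrix (Fin 3) (Fin 3) k) :=
  LinearMap.ker (Matrix.traceLinearMap (Fin 3) k k)

lemma trace_idem3 {k : Type*} [Field k] (P : Matrix (Fin 3) (Fin 3) k) (hP : P * P = P) :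
    ∃ r : ℕ, r ≤ 3 ∧ P.trace = r := by
  have hI : IsIdempotentElem (Matrix.toLin' P) := by
    show Matrix.toLin' P * Matrix.toLin' P = _
    rw [Module.End.mul_eq_comp, ← Matrix.toLin'_mul, hP]
  have h := (LinearMap.IsIdempotentElem.isProj_range _ hI).trace
  rw [Matrix.trace_toLin'_eq] at h
  refine ⟨_, ?_, h⟩
  simpa using Submodule.finrank_le (LinearMap.range (Matrix.toLin' P))

lemma trace_adL {k : Type*} [Field k] (g : Matrix.GeneralLinearGroup (Fin 3) k) :
    LinearMap.trace k _ (adL g) = (g : Matrix (Fin 3) (Fin 3) k).trace *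
      ((g⁻¹ : Matrix.GeneralLinearGroup (Fin 3) k) : Matrix (Fin 3) (Fin 3) k).trace := by
  have key : ∀ (A B : Matrix (Fin 3) (Fin 3) k) (i j : Fin 3),
      (A * Matrix.single i j (1 : k) * B : Matrix (Fin 3) (Fin 3) k) i j = A i i * B j j := by
    intro A B i j
    rw [Matrix.mul_assoc]
    simp [Matrix.mul_apply, Matrix.single_apply, Finset.sum_ite_eq]
    simp [ite_and]
  rw [LinearMap.trace_eq_matrix_trace k (Matrix.stdBasis k (Fin 3) (Fin 3)), Matrix.trace]
  have : ∀ p : Fin 3 × Fin 3, (LinearMap.toMatrix (Matrix.stdBasis k (Fin 3) (Fin 3))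
      (Matrix.stdBasis k (Fin 3) (Fin 3)) (adL g)).diag p =
      (g : Matrix (Fin 3) (Fin 3) k) p.1 p.1 *
      ((g⁻¹ : Matrix.GeneralLinearGroup (Fin 3) k) : Matrix (Fin 3) (Fin 3) k) p.2 p.2 := by
    rintro ⟨i, j⟩
    rw [Matrix.diag_apply, LinearMap.toMatrix_apply, Matrix.stdBasis_eq_single, ← key]
    rfl
  rw [Finset.sum_congr rfl (fun p _ => this p), Fintype.sum_prod_type, Matrix.trace, Matrix.trace,
    Finset.sum_mul_sum]
  rfl

lemma trace_restrict_sl3 {k : Type*} [Field k] [CharZero k]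
    (f : Matrix (Fin 3) (Fin 3) k →ₗ[k] Matrix (Fin 3) (Fin 3) k) (hf1 : f 1 = 1)
    (hpres : ∀ X ∈ sl3 k, f X ∈ sl3 k) :
    LinearMap.trace k (sl3 k) (f.restrict hpres) = LinearMap.trace k _ f - 1 := by
  let q : Matrix (Fin 3) (Fin 3) k →ₗ[k] Matrix (Fin 3) (Fin 3) k :=
    LinearMap.id - (Matrix.traceLinearMap (Fin 3) k k).smulRight ((3 : k)⁻¹ • 1)
  have hq : ∀ X, q X ∈ sl3 k := by
    intro X
    simp [q, sl3, LinearMap.mem_ker]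
  have hq' : ∀ X ∈ sl3 k, q X = X := by
    intro X hX
    have : X.trace = 0 := hX
    simp [q, this]
  have e : f.restrict hpres = (q.codRestrict _ hq) ∘ₗ (f ∘ₗ (sl3 k).subtype) := by
    ext1 X
    apply Subtype.ext
    exact (hq' _ (hpres _ X.2)).symm
  have e2 : (f ∘ₗ (sl3 k).subtype) ∘ₗ (q.codRestrict _ hq) =
      f - (Matrix.traceLinearMap (Fin 3) k k).smulRight ((3 : k)⁻¹ • 1) := by
    ext1 X
    show f (q X) = _
    simp [q, hf1]
  rw [e, LinearMap.trace_comp_comm', e2, map_sub, LinearMap.trace_smulRight]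
  simp

/-- The odd involutions of `GL₃` are outer: if `Ad(g)` is an involution of `M₃(k)` then
it preserves `sl₃`, and its trace on `sl₃` is `0` or `8`; in particular never `-2`. -/
theorem inner_involution_GL3_not_odd
    {k : Type*} [Field k] [IsAlgClosed k] [CharZero k]
    (g : Matrix.GeneralLinearGroup (Fin 3) k)
    (hinv : ∀ X : Matrix (Fin 3) (Fin 3) k, adL g (adL g X) = X) :
    ∃ hpres : ∀ X ∈ sl3 k, adL g X ∈ sl3 k,
      (LinearMap.trace k (sl3 k) ((adL g).restrict hpres) = 0 ∨
        LinearMap.trace k (sl3 k) ((adL g).restrict hpres) = 8) ∧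
      LinearMap.trace k (sl3 k) ((adL g).restrict hpres) ≠ -2 := by
  set A : Matrix (Fin 3) (Fin 3) k := (g : Matrix (Fin 3) (Fin 3) k) with hA
  set B : Matrix (Fin 3) (Fin 3) k :=
    ((g⁻¹ : Matrix.GeneralLinearGroup (Fin 3) k) : Matrix (Fin 3) (Fin 3) k) with hB
  have hAB : A * B = 1 := g.mul_inv
  have hBA : B * A = 1 := g.inv_mul
  have happ : ∀ X, adL g X = A * X * B := fun X => rfl
  have hpres : ∀ X ∈ sl3 k, adL g X ∈ sl3 k := by
    intro X hX
    have h0 : X.trace = 0 := hX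
    show (A * X * B).trace = 0
    rw [Matrix.trace_mul_comm, ← Matrix.mul_assoc, hBA, Matrix.one_mul, h0]
  have hT : LinearMap.trace k (sl3 k) ((adL g).restrict hpres) = A.trace * B.trace - 1 := by
    rw [trace_restrict_sl3 _ (by rw [happ, Matrix.mul_one, hAB]), trace_adL]
  have hcomm : ∀ X, X * (A * A) = (A * A) * X := by
    intro X
    have h := hinv X
    rw [happ, happ] at h
    calc X * (A * A) = (A * (A * X * B) * B) * (A * A) := by rw [h]
      _ = A * A * X * (B * (B * A) * A) := by simp only [Matrix.mul_assoc]
      _ = A * A * X := by rw [hBA, Matrix.mul_one, hBA, Matrix.mul_one]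
  obtain ⟨c, hc⟩ := Matrix.mem_range_scalar_of_commute_single (M := A * A)
    (fun i j _ => hcomm _)
  have hc' : A * A = c • (1 : Matrix (Fin 3) (Fin 3) k) := by
    rw [← hc, Matrix.scalar_apply, Matrix.smul_one_eq_diagonal]
  obtain ⟨a, ha⟩ := IsAlgClosed.exists_pow_nat_eq c (n := 2) (by norm_num)
  have hAcB : A = c • B := by
    calc A = A * A * B := by rw [Matrix.mul_assoc, hAB, Matrix.mul_one]
      _ = c • B := by rw [hc', Matrix.smul_mul, Matrix.one_mul]
  have ha0 : a ≠ 0 := by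
    rintro rfl
    have hc0 : c = 0 := by rw [← ha]; simp
    rw [hc0, zero_smul] at hAcB
    rw [hAcB, Matrix.zero_mul] at hAB
    exact zero_ne_one hAB
  have hP : ((2 : k)⁻¹ • (1 + a⁻¹ • A)) * ((2 : k)⁻¹ • (1 + a⁻¹ • A)) =
      (2 : k)⁻¹ • (1 + a⁻¹ • A) := by
    simp only [Matrix.smul_mul, Matrix.mul_smul, Matrix.add_mul, Matrix.mul_add, Matrix.one_mul,
      Matrix.mul_one, hc', ← ha]
    match_scalars <;> field_simp <;> ring
  obtain ⟨r, hr3, hr⟩ := trace_idem3 _ hP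
  have hA' : A.trace = a * (2 * r - 3) := by
    rw [← hr]
    simp
    field_simp
    ring
  have hB' : B.trace = a⁻¹ * (2 * r - 3) := by
    have h := congrArg Matrix.trace hAcB
    rw [Matrix.trace_smul, hA', ← ha, smul_eq_mul] at h
    field_simp
    apply mul_left_cancel₀ ha0
    rw [h]
    ring
  have hT2 : LinearMap.trace k (sl3 k) ((adL g).restrict hpres) = (2 * (r : k) - 3) ^ 2 - 1 := by
    rw [hT, hA', hB']
    field_simp
  have hor : LinearMap.trace k (sl3 k) ((adL g).restrict hpres) = 0 ∨
        LinearMap.trace k (sl3 k) ((adL g).restrict hpres) = 8 := by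
    rw [hT2]
    interval_cases r <;> norm_num
  refine ⟨hpres, hor, ?_⟩
  rcases hor with h | h <;> rw [h] <;> norm_num
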